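/- arXiv:2501.00894 — 8 statements merged into one kernel-verified Lean document; each statement's English description precedes it below -/
import Mathlib

section
/- Let X be a real symmetric m×m matrix (m ≥ 1). The following three conditions are equivalent: (i) X is positive semidefinite; (ii) for every consecutive principal submatrix of X, at least one of its inner-saturated submatrices has a nonnegative determinant; (iii) for every consecutive principal submatrix of X, every one of its inner-saturated submatrices has a nonnegative determinant. -/
open Matrix

/-- The principal submatrix `Y_{I,I}` of `Y` with rows and columns indexed by `I`. -/
def principalSub {n : ℕ} (Y : Matrix (Fin n) (Fin n) ℝ) (I : Finset (Fin n)) :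
    Matrix I I ℝ :=
  Y.submatrix (fun i => (i : Fin n)) (fun i => (i : Fin n))

/-- `I` is an inner-saturated index set of the `n × n` matrix `Y` (indices `0`-based):
`I = {0, n-1} ∪ J` where `J` is a set of inner indices (those strictly between `0` and `n-1`)
such that the corresponding columns of the inner block `Y_{1:(n-2),1:(n-2)}` form a maximal
linearly independent subset of the columns of the inner block (in particular `J = ∅` when
`n ≤ 2`, since then there are no inner indices). -/
def IsInnerSaturatedSet {n : ℕ} (Y : Matrix (Fin n) (Fin n) ℝ) (I : Finset (Fin n)) : Prop :=
  ∃ J : Finset (Fin n),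
    (∀ j ∈ J, 0 < (j : ℕ) ∧ (j : ℕ) < n - 1) ∧
    LinearIndependent ℝ
      (fun j : J => fun i : {i : Fin n // 0 < (i : ℕ) ∧ (i : ℕ) < n - 1} =>
        Y i.val (j : Fin n)) ∧
    Submodule.span ℝ (Set.range
        (fun j : J => fun i : {i : Fin n // 0 < (i : ℕ) ∧ (i : ℕ) < n - 1} =>
          Y i.val (j : Fin n))) =
      Submodule.span ℝ (Set.range
        (fun j : {i : Fin n // 0 < (i : ℕ) ∧ (i : ℕ) < n - 1} =>
          fun i : {i : Fin n // 0 < (i : ℕ) ∧ (i : ℕ) < n - 1} => Y i.val j.val)) ∧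
    I = Finset.univ.filter (fun i : Fin n => (i : ℕ) = 0 ∨ (i : ℕ) = n - 1) ∪ J

/-- The consecutive principal submatrix of `X` of size `n` starting at (`0`-based) index `a`. -/
def consSub {m : ℕ} (X : Matrix (Fin m) (Fin m) ℝ) (a n : ℕ) (h : a + n ≤ m) :
    Matrix (Fin n) (Fin n) ℝ :=
  X.submatrix (fun i => ⟨a + (i : ℕ), by omega⟩) (fun i => ⟨a + (i : ℕ), by omega⟩)

/-- The quadratic form of a matrix at a vector supported on the range of an injection is the
quadratic form of the corresponding submatrix at the restricted vector. -/
theorem dotProduct_submatrix_mulVec_comp {ι κ : Type*} [Fintype ι] [Fintype κ]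
    (Y : Matrix ι ι ℝ) {f : κ → ι} (hf : Function.Injective f) {x : ι → ℝ}
    (hx : ∀ i ∉ Set.range f, x i = 0) :
    (x ∘ f) ⬝ᵥ (Y.submatrix f f) *ᵥ (x ∘ f) = x ⬝ᵥ Y *ᵥ x := by
  refine Fintype.sum_of_injective f hf _ _ (fun i hi => by simp [hx i hi]) fun k => ?_
  congr 1
  exact Fintype.sum_of_injective f hf _ _ (fun i hi => by simp [hx i hi]) fun l => rfl

theorem dotProduct_submatrix_mulVec_eq_extend {ι κ : Type*} [Fintype ι] [Fintype κ]
    (Y : Matrix ι ι ℝ) {f : κ → ι} (hf : Function.Injective f) (y : κ → ℝ) :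
    y ⬝ᵥ (Y.submatrix f f) *ᵥ y =
      Function.extend f y 0 ⬝ᵥ Y *ᵥ Function.extend f y 0 := by
  rw [← dotProduct_submatrix_mulVec_comp Y hf
    fun i hi => by rw [Function.extend_apply' _ _ _ (by simpa using hi), Pi.zero_apply],
    Function.extend_comp hf]

theorem dotProduct_mulVec_comm_of_isSymm {ι : Type*} [Fintype ι] {Y : Matrix ι ι ℝ}
    (hY : Y.IsSymm) (x y : ι → ℝ) : x ⬝ᵥ Y *ᵥ y = y ⬝ᵥ Y *ᵥ x := by
  rw [dotProduct_mulVec, ← mulVec_transpose, hY.eq, dotProduct_comm]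

/-- If the quadratic form is nonnegative on the hyperplane `x p = 0`, then an isotropic vector of
that hyperplane is annihilated by all rows other than row `p`. -/
theorem mulVec_apply_eq_zero_of_isotropic {ι : Type*} [Fintype ι] [DecidableEq ι]
    {Y : Matrix ι ι ℝ} (hY : Y.IsSymm) {p : ι} (hp : ∀ x : ι → ℝ, x p = 0 → 0 ≤ x ⬝ᵥ Y *ᵥ x)
    {z : ι → ℝ} (hz : z p = 0) (hzz : z ⬝ᵥ Y *ᵥ z = 0) {i : ι} (hi : i ≠ p) :
    (Y *ᵥ z) i = 0 := by
  have key : ∀ t : ℝ, 0 ≤ 2 * t * (Y *ᵥ z) i + t ^ 2 * Y i i := by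
    intro t
    have h := hp (z + Pi.single i t) (by simp [hz, hi.symm])
    rw [mulVec_add, dotProduct_add, add_dotProduct, add_dotProduct, hzz,
      dotProduct_mulVec_comm_of_isSymm hY z] at h
    simp only [single_dotProduct, mulVec_single, Pi.smul_apply, col_apply,
      MulOpposite.smul_eq_mul_unop, MulOpposite.unop_op] at h
    linarith
  have hd : 0 ≤ Y i i := by
    have h := hp (Pi.single i 1) (by simp [hi.symm])
    simpa using h
  by_contra hc
  have h := key (-(Y *ᵥ z) i / (Y i i + 1))
  have hd' : 0 < Y i i + 1 := by linarith
  have heq : 2 * (-(Y *ᵥ z) i / (Y i i + 1)) * (Y *ᵥ z) i +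
      (-(Y *ᵥ z) i / (Y i i + 1)) ^ 2 * Y i i =
      -((Y *ᵥ z) i ^ 2 * (Y i i + 2) / (Y i i + 1) ^ 2) := by
    field_simp
    ring
  have hpos : 0 < (Y *ᵥ z) i ^ 2 * (Y i i + 2) / (Y i i + 1) ^ 2 := by positivity
  linarith

/-- A symmetric real `2 × 2` matrix with nonnegative diagonal and determinant is positive
semidefinite. -/
theorem posSemidef_fin_two_of_det_nonneg {S : Matrix (Fin 2) (Fin 2) ℝ} (hS : S.IsSymm)
    (h0 : 0 ≤ S 0 0) (h1 : 0 ≤ S 1 1) (hdet : 0 ≤ S.det) : S.PosSemidef := by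
  have h10 : S 1 0 = S 0 1 := hS.apply 0 1
  rw [det_fin_two, h10] at hdet
  refine .of_dotProduct_mulVec_nonneg hS fun x => ?_
  simp only [dotProduct, mulVec, Fin.sum_univ_two, star_trivial, h10]
  rcases h0.eq_or_lt with h | h
  · have hb : S 0 1 = 0 := by nlinarith
    rw [← h, hb]
    nlinarith [mul_nonneg h1 (sq_nonneg (x 1))]
  · refine nonneg_of_mul_nonneg_right ?_ h
    nlinarith [sq_nonneg (S 0 0 * x 0 + S 0 1 * x 1), mul_nonneg hdet (sq_nonneg (x 1))]

/-- A symmetric matrix bordering a positive definite block by two further indices is positive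
semidefinite if its determinant is nonnegative and its quadratic form is nonnegative on the
vectors vanishing at one of these two indices. -/
theorem posSemidef_of_posDef_toBlocks₁₁ {κ : Type*} [Fintype κ] [DecidableEq κ]
    {M : Matrix (κ ⊕ Fin 2) (κ ⊕ Fin 2) ℝ} (hM : M.IsSymm) (hA : M.toBlocks₁₁.PosDef)
    (hpos : ∀ (k : Fin 2) (y : κ ⊕ Fin 2 → ℝ), y (Sum.inr k) = 0 → 0 ≤ y ⬝ᵥ M *ᵥ y)
    (hdet : 0 ≤ M.det) : M.PosSemidef := by
  have hblock : M = fromBlocks M.toBlocks₁₁ M.toBlocks₁₂ M.toBlocks₁₂ᴴ M.toBlocks₂₂ := by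
    conv_lhs => rw [← fromBlocks_toBlocks M]
    congr 1
    ext i j
    exact hM.apply _ _
  generalize M.toBlocks₁₁ = A at *
  generalize M.toBlocks₁₂ = B at *
  generalize M.toBlocks₂₂ = D at *
  subst hblock
  let : Invertible A := hA.isUnit.invertible
  rw [det_fromBlocks₁₁, invOf_eq_nonsing_inv] at hdet
  have hS : (D - Bᴴ * A⁻¹ * B).IsHermitian := (IsHermitian.fromBlocks₁₁ B D hA.1).1 hM
  have hdiag : ∀ k l : Fin 2, l ≠ k → 0 ≤ (D - Bᴴ * A⁻¹ * B) k k := by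
    intro k l hl
    have h := hpos l (Sum.elim (-((A⁻¹ * B) *ᵥ Pi.single k 1)) (Pi.single k 1))
      (by simp [hl])
    have h2 := schur_complement_eq₁₁ B D (-((A⁻¹ * B) *ᵥ Pi.single k 1)) (Pi.single k 1) hA.1
    rw [neg_add_cancel, dotProduct_zero, zero_add, ← dotProduct_mulVec, ← dotProduct_mulVec,
      star_trivial, star_trivial] at h2
    rw [h2] at h
    simpa using h
  exact (PosDef.fromBlocks₁₁ B D hA).2 (posSemidef_fin_two_of_det_nonneg hS
    (hdiag 0 1 (by simp)) (hdiag 1 0 (by simp)) (nonneg_of_mul_nonneg_right hdet hA.det_pos))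

/-- If the quadratic form of a symmetric matrix is nonnegative on the vectors vanishing at `p`
and on those vanishing at `q`, the columns `J` form a basis of the column space of the block of
indices other than `p` and `q`, and the principal minor on `J ∪ {p, q}` is nonnegative, then the
matrix is positive semidefinite. -/
theorem posSemidef_of_saturated_det_nonneg {ι : Type*} [Fintype ι] [DecidableEq ι]
    {Y : Matrix ι ι ℝ} (hY : Y.IsSymm) {p q : ι} (hpq : p ≠ q)
    (hp : ∀ x : ι → ℝ, x p = 0 → 0 ≤ x ⬝ᵥ Y *ᵥ x) (hq : ∀ x : ι → ℝ, x q = 0 → 0 ≤ x ⬝ᵥ Y *ᵥ x)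
    {P : ι → Prop} (hP : ∀ i, P i ↔ i ≠ p ∧ i ≠ q) {J : Finset ι} (hJ : ∀ j ∈ J, P j)
    (hli : LinearIndependent ℝ (fun j : J => fun i : {i // P i} => Y i.val (j : ι)))
    (hspan : Submodule.span ℝ (Set.range (fun j : J => fun i : {i // P i} => Y i.val (j : ι))) =
      Submodule.span ℝ (Set.range (fun j : {i // P i} => fun i : {i // P i} => Y i.val j.val)))
    {I : Finset ι} (hI : ∀ i, i ∈ I ↔ i = p ∨ i = q ∨ i ∈ J)
    (hdet : 0 ≤ (Y.submatrix (fun i : I => (i : ι)) (fun i : I => (i : ι))).det) :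
    Y.PosSemidef := by
  classical
  have hpJ : p ∉ J := fun h => ((hP p).1 (hJ p h)).1 rfl
  have hqJ : q ∉ J := fun h => ((hP q).1 (hJ q h)).2 rfl
  have hker : ∀ z : ι → ℝ, z p = 0 → z q = 0 → z ⬝ᵥ Y *ᵥ z = 0 → Y *ᵥ z = 0 := by
    intro z hzp hzq hzz
    ext i
    by_cases hi : i = p
    · exact mulVec_apply_eq_zero_of_isotropic hY hq hzq hzz (hi ▸ hpq)
    · exact mulVec_apply_eq_zero_of_isotropic hY hp hzp hzz hi
  have hval : Function.Injective (fun j : J => (j : ι)) := Subtype.val_injective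
  have hJdef : (Y.submatrix (fun j : J => (j : ι)) (fun j : J => (j : ι))).PosDef := by
    refine .of_dotProduct_mulVec_pos (hY.submatrix _) fun x hx => ?_
    rw [star_trivial, dotProduct_submatrix_mulVec_eq_extend Y hval]
    have hext : ∀ i ∉ J, Function.extend (fun j : J => (j : ι)) x 0 i = 0 := fun i hi =>
      Function.extend_apply' _ _ _ (by rintro ⟨j, rfl⟩; exact hi j.2)
    refine lt_of_le_of_ne (hp _ (hext p hpJ)) fun h => hx ?_
    have hz := hker _ (hext p hpJ) (hext q hqJ) h.symm
    ext j
    refine Fintype.linearIndependent_iff.1 hli x ?_ j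
    ext i
    rw [Finset.sum_apply, Pi.zero_apply, ← Pi.zero_apply (M := fun _ => ℝ) i.val, ← hz]
    refine Fintype.sum_of_injective _ hval _ _
      (fun i hi => by simp [hext i (by simpa using hi)]) fun k => ?_
    rw [hval.extend_apply]
    simp [mul_comm]
  let f : J ⊕ Fin 2 → ι := Sum.elim (fun j => (j : ι)) ![p, q]
  have hf : Function.Injective f := by
    refine hval.sumElim ?_ ?_
    · intro k l
      fin_cases k <;> fin_cases l <;> simp [hpq, hpq.symm]
    · intro j k
      have := j.2
      fin_cases k <;> simp <;> rintro rfl <;> contradiction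
  have hrange : ∀ i, i ∈ Set.range f ↔ i ∈ I := by
    intro i
    simp only [hI, f, Set.mem_range, Sum.exists, Sum.elim_inl, Sum.elim_inr, Fin.exists_fin_two]
    simp only [Subtype.exists, exists_prop, exists_eq_right, cons_val_zero, cons_val_one]
    grind
  have hsub : (Y.submatrix f f).PosSemidef := by
    refine posSemidef_of_posDef_toBlocks₁₁ (hY.submatrix f) hJdef ?_ ?_
    · intro k y hy
      rw [dotProduct_submatrix_mulVec_eq_extend Y hf]
      have hk := hf.extend_apply y 0 (Sum.inr k)
      rw [hy] at hk
      fin_cases k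
      · exact hp _ hk
      · exact hq _ hk
    · let e : J ⊕ Fin 2 ≃ I := Equiv.ofBijective (fun k => ⟨f k, (hrange _).1 ⟨k, rfl⟩⟩)
        ⟨fun k l h => hf (Subtype.ext_iff.1 h), fun i => by
          obtain ⟨k, hk⟩ := (hrange i).2 i.2
          exact ⟨k, Subtype.ext hk⟩⟩
      rwa [← det_submatrix_equiv_self e] at hdet
  refine .of_dotProduct_mulVec_nonneg hY fun x => ?_
  rw [star_trivial]
  obtain ⟨c, hc⟩ : ∃ c : J → ℝ, ∑ j, c j • (fun i : {i // P i} => Y i.val (j : ι)) =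
      ∑ j : {i // P i}, x j • (fun i : {i // P i} => Y i.val j.val) := by
    rw [← Submodule.mem_span_range_iff_exists_fun, hspan]
    exact Submodule.sum_mem _ fun j _ => Submodule.smul_mem _ _ (Submodule.subset_span ⟨j, rfl⟩)
  set w : ι → ℝ := Function.extend (fun j : J => (j : ι)) c 0 with hw
  have hw0 : ∀ i ∉ J, w i = 0 := fun i hi =>
    Function.extend_apply' _ _ _ (by rintro ⟨j, rfl⟩; exact hi j.2)
  set v : ι → ℝ := fun i => if P i then x i else 0 with hv
  have hvp : v p = 0 := by simp [hv, hP]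
  have hvq : v q = 0 := by simp [hv, hP]
  have hzin : ∀ i, P i → (Y *ᵥ (v - w)) i = 0 := by
    intro i hi
    have h := congrFun hc ⟨i, hi⟩
    simp only [Finset.sum_apply, Pi.smul_apply, smul_eq_mul] at h
    have h1 : ∑ j : J, c j * Y i j = (Y *ᵥ w) i :=
      Fintype.sum_of_injective _ hval _ _
        (fun i hi => by simp [hw0 i (by simpa using hi)])
        fun k => by rw [hw, hval.extend_apply, mul_comm]
    have h2 : ∑ j : {i // P i}, x j * Y i j = (Y *ᵥ v) i :=
      Fintype.sum_of_injective (fun j : {i // P i} => (j : ι)) Subtype.val_injective _ _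
        (fun i hi => by
          have : ¬ P i := by simpa using hi
          simp [hv, this])
        fun k => by simp [hv, k.2, mul_comm]
    rw [mulVec_sub, Pi.sub_apply, ← h1, ← h2, h, sub_self]
  have hzp : (v - w) p = 0 := by simp [hvp, hw0 p hpJ]
  have hzq : (v - w) q = 0 := by simp [hvq, hw0 q hqJ]
  have hz : Y *ᵥ (v - w) = 0 := by
    refine hker _ hzp hzq (Finset.sum_eq_zero fun i _ => ?_)
    by_cases hi : P i
    · rw [hzin i hi, mul_zero]
    · rcases not_and_or.1 (mt (hP i).2 hi) with h | h
      · rw [not_not.1 h, hzp, zero_mul]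
      · rw [not_not.1 h, hzq, zero_mul]
  have hx : x ⬝ᵥ Y *ᵥ x = (x - (v - w)) ⬝ᵥ Y *ᵥ (x - (v - w)) := by
    rw [mulVec_sub, hz, sub_zero, sub_dotProduct, dotProduct_mulVec_comm_of_isSymm hY (v - w), hz,
      dotProduct_zero, sub_zero]
  rw [hx, ← dotProduct_submatrix_mulVec_comp Y hf]
  · exact hsub.dotProduct_mulVec_nonneg _
  · intro i hi
    rw [hrange, hI] at hi
    push Not at hi
    simp [hv, (hP i).2 ⟨hi.1, hi.2.1⟩, hw0 i hi.2.2]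

theorem exists_isInnerSaturatedSet {n : ℕ} (Y : Matrix (Fin n) (Fin n) ℝ) :
    ∃ I, IsInnerSaturatedSet Y I := by
  classical
  obtain ⟨κ, a, ha, hspan, hli⟩ := exists_linearIndependent' ℝ
    (fun j : {i : Fin n // 0 < (i : ℕ) ∧ (i : ℕ) < n - 1} =>
      fun i : {i : Fin n // 0 < (i : ℕ) ∧ (i : ℕ) < n - 1} => Y i.val j.val)
  let J : Finset (Fin n) := Finset.univ.filter fun i => ∃ k, (a k : Fin n) = i
  let e : κ ≃ J := Equiv.ofBijective (fun k => ⟨a k, by simp [J]⟩)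
    ⟨fun k l h => ha (Subtype.ext (congrArg (fun j : J => (j : Fin n)) h)), fun j => by
      obtain ⟨k, hk⟩ := (Finset.mem_filter.1 j.2).2
      exact ⟨k, Subtype.ext hk⟩⟩
  refine ⟨_, J, ?_, ?_, ?_, rfl⟩
  · intro j hj
    obtain ⟨k, rfl⟩ := (Finset.mem_filter.1 hj).2
    exact (a k).2
  · exact (linearIndependent_equiv e).1 hli
  · rw [← hspan, ← e.surjective.range_comp]
    rfl

/-- A symmetric matrix of size `n + 2` is positive semidefinite if some inner-saturated principal
minor of it is nonnegative and its leading and trailing principal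
submatrices of size `n + 1` are positive semidefinite. -/
theorem posSemidef_of_isInnerSaturatedSet {n : ℕ} {Y : Matrix (Fin (n + 2)) (Fin (n + 2)) ℝ}
    (hY : Y.IsSymm) (hfirst : (Y.submatrix Fin.castSucc Fin.castSucc).PosSemidef)
    (hlast : (Y.submatrix Fin.succ Fin.succ).PosSemidef) {I : Finset (Fin (n + 2))}
    (hI : IsInnerSaturatedSet Y I) (hdet : 0 ≤ (principalSub Y I).det) : Y.PosSemidef := by
  obtain ⟨J, hJ, hli, hspan, rfl⟩ := hI
  refine posSemidef_of_saturated_det_nonneg hY (p := 0) (q := Fin.last _) (by simp [Fin.ext_iff])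
    ?_ ?_ ?_ hJ hli hspan ?_ hdet
  · intro x hx
    rw [← dotProduct_submatrix_mulVec_comp Y (Fin.succ_injective _)]
    · exact hlast.dotProduct_mulVec_nonneg _
    · intro i hi
      rw [Fin.range_succ, Set.mem_compl_singleton_iff, not_not] at hi
      rw [hi, hx]
  · intro x hx
    rw [← dotProduct_submatrix_mulVec_comp Y (Fin.castSucc_injective _)]
    · exact hfirst.dotProduct_mulVec_nonneg _
    · intro i hi
      rw [Fin.range_castSucc, Set.mem_ofPred_eq] at hi
      rw [← hx]
      congr 1
      rw [Fin.ext_iff, Fin.val_last]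
      omega
  · intro i
    simp only [ne_eq, Fin.ext_iff, Fin.val_zero, Fin.val_last]
    omega
  · intro i
    simp only [Finset.mem_union, Finset.mem_filter, Finset.mem_univ, true_and, Fin.ext_iff,
      Fin.val_zero, Fin.val_last, or_assoc]
    rfl

theorem consSub_posSemidef {m : ℕ} {X : Matrix (Fin m) (Fin m) ℝ} (hX : X.IsSymm)
    (H : ∀ (a n : ℕ) (_ : 1 ≤ n) (h : a + n ≤ m),
      ∃ I : Finset (Fin n), IsInnerSaturatedSet (consSub X a n h) I ∧
        0 ≤ (principalSub (consSub X a n h) I).det) (n : ℕ) :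
    ∀ (a : ℕ) (h : a + (n + 1) ≤ m), (consSub X a (n + 1) h).PosSemidef := by
  induction n with
  | zero =>
    intro a h
    obtain ⟨I, ⟨J, hJ, -, -, rfl⟩, hdet⟩ := H a 1 le_rfl h
    have hmem : (0 : Fin 1) ∈ Finset.univ.filter (fun i : Fin 1 => (i : ℕ) = 0 ∨ (i : ℕ) = 1 - 1)
      ∪ J := by simp
    rw [det_eq_elem_of_subsingleton _ ⟨0, hmem⟩] at hdet
    change (consSub X a 1 h).PosSemidef
    refine .of_dotProduct_mulVec_nonneg (hX.submatrix _) fun x => ?_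
    simp only [dotProduct, mulVec, Fin.sum_univ_one, star_trivial]
    have := mul_nonneg hdet (sq_nonneg (x 0))
    simp only [principalSub, submatrix_apply] at this
    exact this.trans_eq (by ring)
  | succ n ih =>
    intro a h
    obtain ⟨I, hI, hdet⟩ := H a (n + 2) (by omega) h
    refine posSemidef_of_isInnerSaturatedSet (hX.submatrix _) (ih a (by omega)) ?_ hI hdet
    convert ih (a + 1) (by omega) using 1
    ext i j
    simp only [consSub, submatrix_apply, Fin.val_succ]
    congr 2 <;> omega

/-- **A stronger Sylvester's criterion for positive semidefinite matrices.**
For a real symmetric `m × m` matrix `X` (`m ≥ 1`), the following are equivalent: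
(i) `X` is positive semidefinite;
(ii) for every consecutive principal submatrix of `X`, at least one of its inner-saturated
submatrices has a nonnegative determinant;
(iii) for every consecutive principal submatrix of `X`, every one of its inner-saturated
submatrices has a nonnegative determinant. -/
theorem stmt_2 (m : ℕ) (hm : 1 ≤ m) (X : Matrix (Fin m) (Fin m) ℝ) (hX : X.IsSymm) :
    (X.PosSemidef ↔
      ∀ (a n : ℕ) (_ : 1 ≤ n) (h : a + n ≤ m),
        ∃ I : Finset (Fin n), IsInnerSaturatedSet (consSub X a n h) I ∧
          0 ≤ (principalSub (consSub X a n h) I).det) ∧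
    (X.PosSemidef ↔
      ∀ (a n : ℕ) (_ : 1 ≤ n) (h : a + n ≤ m),
        ∀ I : Finset (Fin n), IsInnerSaturatedSet (consSub X a n h) I →
          0 ≤ (principalSub (consSub X a n h) I).det) := by
  have h13 : X.PosSemidef → ∀ (a n : ℕ) (_ : 1 ≤ n) (h : a + n ≤ m),
      ∀ I : Finset (Fin n), IsInnerSaturatedSet (consSub X a n h) I →
        0 ≤ (principalSub (consSub X a n h) I).det :=
    fun hpsd a n _ h I _ => ((hpsd.submatrix _).submatrix _).det_nonneg
  have h32 : (∀ (a n : ℕ) (_ : 1 ≤ n) (h : a + n ≤ m),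
      ∀ I : Finset (Fin n), IsInnerSaturatedSet (consSub X a n h) I →
        0 ≤ (principalSub (consSub X a n h) I).det) →
      ∀ (a n : ℕ) (_ : 1 ≤ n) (h : a + n ≤ m),
        ∃ I : Finset (Fin n), IsInnerSaturatedSet (consSub X a n h) I ∧
          0 ≤ (principalSub (consSub X a n h) I).det := by
    intro H a n hn h
    obtain ⟨I, hI⟩ := exists_isInnerSaturatedSet (consSub X a n h)
    exact ⟨I, hI, H a n hn h I hI⟩
  have h21 : (∀ (a n : ℕ) (_ : 1 ≤ n) (h : a + n ≤ m),
      ∃ I : Finset (Fin n), IsInnerSaturatedSet (consSub X a n h) I ∧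
        0 ≤ (principalSub (consSub X a n h) I).det) → X.PosSemidef := by
    intro H
    obtain ⟨k, rfl⟩ := Nat.exists_eq_add_of_le' hm
    convert consSub_posSemidef hX H k 0 (by omega) using 1
    ext i j
    simp [consSub]
  exact ⟨⟨fun h => h32 (h13 h), h21⟩, ⟨h13, fun h => h21 (h32 h)⟩⟩
end

section
/- Let X be a real symmetric m×m matrix (m ≥ 2) such that both X_{1:(m−1),1:(m−1)} and X_{2:m,2:m} are positive definite. Then X is positive definite if and only if det(X) > 0. -/
open Matrix

/-- The leading principal submatrix `X_{1:(m-1),1:(m-1)}` (`0`-based: rows/cols `0,…,m-2`). -/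
def leadSub {m : ℕ} (X : Matrix (Fin m) (Fin m) ℝ) : Matrix (Fin (m - 1)) (Fin (m - 1)) ℝ :=
  X.submatrix (fun i => ⟨(i : ℕ), by omega⟩) (fun i => ⟨(i : ℕ), by omega⟩)

/-- The trailing principal submatrix `X_{2:m,2:m}` (`0`-based: rows/cols `1,…,m-1`). -/
def tailSub {m : ℕ} (X : Matrix (Fin m) (Fin m) ℝ) : Matrix (Fin (m - 1)) (Fin (m - 1)) ℝ :=
  X.submatrix (fun i => ⟨(i : ℕ) + 1, by omega⟩) (fun i => ⟨(i : ℕ) + 1, by omega⟩)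

/-- If `X` is a real symmetric `m × m` matrix (`m ≥ 2`) whose principal submatrices
`X_{1:(m-1),1:(m-1)}` and `X_{2:m,2:m}` are both positive definite, then `X` is positive
definite if and only if `det X > 0`. -/
theorem stmt_3 (m : ℕ) (hm : 2 ≤ m) (X : Matrix (Fin m) (Fin m) ℝ) (hX : X.IsSymm)
    (h1 : (leadSub X).PosDef) (h2 : (tailSub X).PosDef) :
    X.PosDef ↔ 0 < X.det := by
  refine ⟨fun h => h.det_pos, fun hdet => ?_⟩
  obtain ⟨n, rfl⟩ : ∃ n, m = n + 1 := ⟨m - 1, by omega⟩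
  let e : Fin n ⊕ Fin 1 ≃ Fin (n + 1) := finSumFinEquiv
  let Y := X.submatrix e e
  have hY₁₁ : Y.toBlocks₁₁.PosDef := h1
  have hY₂₁ : Y.toBlocks₂₁ = Y.toBlocks₁₂ᴴ := by
    ext i j
    exact hX.apply _ _
  have hdetY : 0 < Y.det := by rwa [det_submatrix_equiv_self]
  have hY : Y = fromBlocks Y.toBlocks₁₁ Y.toBlocks₁₂ Y.toBlocks₁₂ᴴ Y.toBlocks₂₂ := by
    rw [← hY₂₁, fromBlocks_toBlocks]
  have : Invertible Y.toBlocks₁₁ := hY₁₁.isUnit.invertible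
  have hpsd : Y.PosSemidef := by
    rw [hY, hY₁₁.fromBlocks₁₁]
    rw [hY, det_fromBlocks₁₁, mul_pos_iff_of_pos_left hY₁₁.det_pos, det_fin_one,
      invOf_eq_nonsing_inv] at hdetY
    set S := Y.toBlocks₂₂ - Y.toBlocks₁₂ᴴ * Y.toBlocks₁₁⁻¹ * Y.toBlocks₁₂
    have hS : S = diagonal fun _ => S 0 0 := by
      ext i j
      fin_cases i, j
      simp
    rw [hS]
    exact PosSemidef.diagonal fun _ => hdetY.le
  have hXpsd : X.PosSemidef := (posSemidef_submatrix_equiv e).mp hpsd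
  exact hXpsd.posDef_iff_det_ne_zero.mpr hdet.ne'
end

section
/- Let X be a real symmetric m×m matrix (m ≥ 2) such that both X_{1:(m−1),1:(m−1)} and X_{2:m,2:m} are positive definite. Then there exists a real number k such that the symmetric matrix X(k), obtained from X by replacing the entries in positions (1,m) and (m,1) by k, is positive definite. -/
open Matrix

/-- `X(t)`: the matrix obtained from `X` by replacing the entries in the two corner positions
`(1,m)` and `(m,1)` (i.e. `(0, m-1)` and `(m-1, 0)` in `0`-based indexing) by `t`. -/
def updCorner {m : ℕ} (X : Matrix (Fin m) (Fin m) ℝ) (t : ℝ) : Matrix (Fin m) (Fin m) ℝ :=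
  fun i j =>
    if ((i : ℕ) = 0 ∧ (j : ℕ) = m - 1) ∨ ((i : ℕ) = m - 1 ∧ (j : ℕ) = 0) then t else X i j

theorem dotProduct_mulVec_cons {n : ℕ} {M : Matrix (Fin (n + 1)) (Fin (n + 1)) ℝ}
    (hM : M.IsSymm) (a : ℝ) (y : Fin n → ℝ) :
    (Fin.cons a y : Fin (n + 1) → ℝ) ⬝ᵥ (M *ᵥ (Fin.cons a y : Fin (n + 1) → ℝ)) =
      a ^ 2 * M 0 0 + 2 * a * ((fun j => M 0 j.succ) ⬝ᵥ y) +
        y ⬝ᵥ (M.submatrix Fin.succ Fin.succ *ᵥ y) := by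
  have h : ∀ i : Fin n, M i.succ 0 = M 0 i.succ := fun i => hM.apply _ _
  simp only [dotProduct, mulVec, Fin.sum_univ_succ, Fin.cons_zero, Fin.cons_succ, submatrix_apply,
    h, mul_add, Finset.sum_add_distrib]
  have e : ∑ i : Fin n, y i * (M 0 i.succ * a) = a * ∑ i : Fin n, M 0 i.succ * y i := by
    rw [Finset.mul_sum]
    exact Finset.sum_congr rfl fun _ _ => by ring
  rw [e]
  ring

theorem dotProduct_mulVec_snoc {n : ℕ} {M : Matrix (Fin (n + 1)) (Fin (n + 1)) ℝ}
    (hM : M.IsSymm) (y : Fin n → ℝ) (b : ℝ) :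
    (Fin.snoc y b : Fin (n + 1) → ℝ) ⬝ᵥ (M *ᵥ (Fin.snoc y b : Fin (n + 1) → ℝ)) =
      y ⬝ᵥ (M.submatrix Fin.castSucc Fin.castSucc *ᵥ y) +
        2 * b * ((fun j => M (Fin.last n) j.castSucc) ⬝ᵥ y) + b ^ 2 * M (Fin.last n) (Fin.last n) := by
  have h : ∀ i : Fin n, M i.castSucc (Fin.last n) = M (Fin.last n) i.castSucc :=
    fun i => hM.apply _ _
  simp only [dotProduct, mulVec, Fin.sum_univ_castSucc, Fin.snoc_castSucc, Fin.snoc_last,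
    submatrix_apply, h, mul_add, Finset.sum_add_distrib]
  have e : ∑ i : Fin n, y i * (M (Fin.last n) i.castSucc * b) =
      b * ∑ i : Fin n, M (Fin.last n) i.castSucc * y i := by
    rw [Finset.mul_sum]
    exact Finset.sum_congr rfl fun _ _ => by ring
  rw [e]
  ring

theorem updCorner_isSymm {m : ℕ} {X : Matrix (Fin m) (Fin m) ℝ} (hX : X.IsSymm) (t : ℝ) :
    (updCorner X t).IsSymm := by
  ext i j
  have h := hX.apply i j
  simp only [transpose_apply, updCorner, h]
  congr 1
  grind

/-- If `X` is a real symmetric `m × m` matrix (`m ≥ 2`) whose principal submatrices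
`X_{1:(m-1),1:(m-1)}` and `X_{2:m,2:m}` are both positive definite, then there exists a real
number `k` such that setting `X_{1,m} = X_{m,1} = k` makes the matrix positive definite. -/
theorem stmt_4 (m : ℕ) (hm : 2 ≤ m) (X : Matrix (Fin m) (Fin m) ℝ) (hX : X.IsSymm)
    (h1 : (leadSub X).PosDef) (h2 : (tailSub X).PosDef) :
    ∃ k : ℝ, (updCorner X k).PosDef := by
  obtain ⟨n, rfl⟩ := Nat.exists_eq_add_of_le' hm
  -- the leading and trailing blocks, their common block `B`, and the two border vectors
  let L : Matrix (Fin (n + 1)) (Fin (n + 1)) ℝ := X.submatrix Fin.castSucc Fin.castSucc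
  let T : Matrix (Fin (n + 1)) (Fin (n + 1)) ℝ := X.submatrix Fin.succ Fin.succ
  let B : Matrix (Fin n) (Fin n) ℝ := L.submatrix Fin.succ Fin.succ
  let u : Fin n → ℝ := fun j => L 0 j.succ
  let v : Fin n → ℝ := fun j => T (Fin.last n) j.castSucc
  have hL : L.PosDef := h1
  have hT : T.PosDef := h2
  have hLs : L.IsSymm := hX.submatrix _
  have hTs : T.IsSymm := hX.submatrix _
  have hBT : T.submatrix Fin.castSucc Fin.castSucc = B := rfl
  have hB : B.PosDef := hL.submatrix (Fin.succ_injective n)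
  have hBs : B.IsSymm := hLs.submatrix _
  obtain ⟨q, hq⟩ : ∃ q, B *ᵥ q = v :=
    ⟨B⁻¹ *ᵥ v, by rw [mulVec_mulVec, mul_nonsing_inv _ hB.det_pos.ne'.isUnit, one_mulVec]⟩
  refine ⟨u ⬝ᵥ q, ?_⟩
  set Y := updCorner X (u ⬝ᵥ q) with hYdef
  have hYs : Y.IsSymm := updCorner_isSymm hX _
  have hYL : Y.submatrix Fin.castSucc Fin.castSucc = L := by
    ext i j
    have := i.isLt
    have := j.isLt
    simp only [hYdef, submatrix_apply, updCorner, Fin.val_castSucc, L]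
    rw [if_neg (by omega)]
  have hYl : Y (Fin.last _) (Fin.last _) = T (Fin.last n) (Fin.last n) := by
    simp [hYdef, updCorner, T]
  have hYb : (fun j : Fin (n + 1) => Y (Fin.last _) j.castSucc) = Fin.cons (u ⬝ᵥ q) v := by
    funext j
    refine Fin.cases ?_ (fun j => ?_) j
    · simp [hYdef, updCorner]
    · simp [hYdef, updCorner, v, T]
  have hdot : ∀ a y, (Fin.cons (u ⬝ᵥ q) v : Fin (n + 1) → ℝ) ⬝ᵥ (Fin.cons a y : Fin (n + 1) → ℝ) =
      (u ⬝ᵥ q) * a + v ⬝ᵥ y := fun a y => by simp [dotProduct, Fin.sum_univ_succ]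
  refine PosDef.of_dotProduct_mulVec_pos
    (by rwa [IsHermitian, conjTranspose_eq_transpose_of_trivial]) ?_
  intro c hc
  obtain ⟨a, y, b, rfl⟩ : ∃ (a : ℝ) (y : Fin n → ℝ) (b : ℝ),
      c = Fin.snoc (Fin.cons a y : Fin (n + 1) → ℝ) b :=
    ⟨c 0, fun i => c i.succ.castSucc, c (Fin.last _), by
      funext i
      refine Fin.lastCases ?_ (fun i => ?_) i
      · simp
      · rw [Fin.snoc_castSucc]
        exact Fin.cases rfl (fun _ => rfl) i⟩
  have hqs : 0 < T (Fin.last n) (Fin.last n) - v ⬝ᵥ q := by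
    have := hT.dotProduct_mulVec_pos (x := (Fin.snoc (-q) 1 : Fin (n + 1) → ℝ))
      (fun h => by simpa using congrFun h (Fin.last n))
    rw [star_trivial, dotProduct_mulVec_snoc hTs, hBT, mulVec_neg, hq, neg_dotProduct_neg,
      dotProduct_neg, dotProduct_comm q v] at this
    change 0 < v ⬝ᵥ q + 2 * 1 * -(v ⬝ᵥ q) + _ at this
    linarith
  have hsplit : (Fin.snoc (Fin.cons a y : Fin (n + 1) → ℝ) b : Fin (n + 2) → ℝ) ⬝ᵥ
      (Y *ᵥ (Fin.snoc (Fin.cons a y : Fin (n + 1) → ℝ) b : Fin (n + 2) → ℝ)) =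
      (Fin.cons a (y + b • q) : Fin (n + 1) → ℝ) ⬝ᵥ
        (L *ᵥ (Fin.cons a (y + b • q) : Fin (n + 1) → ℝ)) +
      b ^ 2 * (T (Fin.last n) (Fin.last n) - v ⬝ᵥ q) := by
    have hqy : q ⬝ᵥ (B *ᵥ y) = v ⬝ᵥ y := by
      rw [dotProduct_mulVec, ← mulVec_transpose, hBs.eq, hq]
    rw [dotProduct_mulVec_snoc hYs, hYL, hYl, hYb, hdot, dotProduct_mulVec_cons hLs,
      dotProduct_mulVec_cons hLs]
    change a ^ 2 * L 0 0 + 2 * a * (u ⬝ᵥ y) + y ⬝ᵥ (B *ᵥ y) + _ + _ =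
      a ^ 2 * L 0 0 + 2 * a * (u ⬝ᵥ (y + b • q)) + (y + b • q) ⬝ᵥ (B *ᵥ (y + b • q)) + _
    simp only [mulVec_add, mulVec_smul, dotProduct_add, add_dotProduct, smul_dotProduct,
      dotProduct_smul, smul_eq_mul, hq, hqy, dotProduct_comm y v, dotProduct_comm q v]
    ring
  rw [star_trivial, hsplit]
  by_cases hb : b = 0
  · subst hb
    have := hL.dotProduct_mulVec_pos (x := (Fin.cons a y : Fin (n + 1) → ℝ)) (fun h => hc (by
      rw [h]
      funext i
      refine Fin.lastCases ?_ (fun i => ?_) i <;> simp))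
    simpa using this
  · have := hL.posSemidef.dotProduct_mulVec_nonneg (Fin.cons a (y + b • q) : Fin (n + 1) → ℝ)
    rw [star_trivial] at this
    have := mul_pos (pow_pos (abs_pos.mpr hb) 2) hqs
    rw [sq_abs] at this
    linarith
end

section
/- Let X be a real symmetric m×m matrix (m ≥ 2) such that both X_{1:(m−1),1:(m−1)} and X_{2:m,2:m} are positive semidefinite. Then there exists a real number k such that the symmetric matrix X(k), obtained from X by replacing the entries in positions (1,m) and (m,1) by k, is positive semidefinite. -/
open Matrix

/-- Border expansion of a symmetric quadratic form along the first row and column. -/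
theorem Matrix.IsSymm.dotProduct_mulVec_eq_succ {n : ℕ} {M : Matrix (Fin (n + 1)) (Fin (n + 1)) ℝ}
    (hM : M.IsSymm) (w : Fin (n + 1) → ℝ) :
    w ⬝ᵥ M *ᵥ w = M 0 0 * w 0 ^ 2 + 2 * w 0 * ((fun i : Fin n => M 0 i.succ) ⬝ᵥ fun i => w i.succ)
      + (fun i : Fin n => w i.succ) ⬝ᵥ M.submatrix Fin.succ Fin.succ *ᵥ fun i => w i.succ := by
  have h : ∑ i : Fin n, w i.succ * (M i.succ 0 * w 0)
      = w 0 * ∑ i : Fin n, M 0 i.succ * w i.succ := by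
    rw [Finset.mul_sum]
    refine Finset.sum_congr rfl fun i _ => ?_
    rw [hM.apply]
    ring
  simp only [dotProduct, mulVec, Fin.sum_univ_succ, submatrix_apply, mul_add,
    Finset.sum_add_distrib, h]
  ring

/-- Border expansion of a symmetric quadratic form along the last row and column. -/
theorem Matrix.IsSymm.dotProduct_mulVec_eq_castSucc {n : ℕ}
    {M : Matrix (Fin (n + 1)) (Fin (n + 1)) ℝ} (hM : M.IsSymm) (w : Fin (n + 1) → ℝ) :
    w ⬝ᵥ M *ᵥ w = M (Fin.last n) (Fin.last n) * w (Fin.last n) ^ 2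
      + 2 * w (Fin.last n) *
        ((fun i : Fin n => M (Fin.last n) i.castSucc) ⬝ᵥ fun i => w i.castSucc)
      + (fun i : Fin n => w i.castSucc) ⬝ᵥ
        M.submatrix Fin.castSucc Fin.castSucc *ᵥ fun i => w i.castSucc := by
  have h : ∑ i : Fin n, w i.castSucc * (M i.castSucc (Fin.last n) * w (Fin.last n))
      = w (Fin.last n) * ∑ i : Fin n, M (Fin.last n) i.castSucc * w i.castSucc := by
    rw [Finset.mul_sum]
    refine Finset.sum_congr rfl fun i _ => ?_
    rw [hM.apply]
    ring
  simp only [dotProduct, mulVec, Fin.sum_univ_castSucc, submatrix_apply, mul_add,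
    Finset.sum_add_distrib, h]
  ring

/-- A vector orthogonal to the kernel of a symmetric matrix lies in its range. -/
theorem Matrix.IsSymm.exists_mulVec_eq {ι : Type*} [Fintype ι]
    {B : Matrix ι ι ℝ} (hB : B.IsSymm) {b : ι → ℝ} (hb : ∀ y, B *ᵥ y = 0 → b ⬝ᵥ y = 0) :
    ∃ u, B *ᵥ u = b := by
  classical
  have hT : (Matrix.toEuclideanLin B).IsSymmetric :=
    Matrix.isSymmetric_toEuclideanLin_iff.2 ((conjTranspose_eq_transpose_of_trivial B).trans hB)
  have hmem : WithLp.toLp 2 b ∈ LinearMap.range (Matrix.toEuclideanLin B) := by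
    rw [← Submodule.orthogonal_orthogonal (LinearMap.range (Matrix.toEuclideanLin B)),
      hT.orthogonal_range, Submodule.mem_orthogonal]
    intro y hy
    have hy' : B *ᵥ y.ofLp = 0 := by
      simpa [Matrix.toLpLin_apply] using hy
    simpa [EuclideanSpace.inner_eq_star_dotProduct] using hb _ hy'
  obtain ⟨u, hu⟩ := hmem
  exact ⟨u.ofLp, by simpa [Matrix.toLpLin_apply] using congrArg WithLp.ofLp hu⟩

/-- If bordering `B` by a row `b` and a corner entry `a` yields a nonnegative quadratic form, then
`b = B u` for some `u` with `u ⬝ᵥ b ≤ a`. -/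
theorem Matrix.IsSymm.exists_mulVec_eq_of_bordered_nonneg {ι : Type*} [Fintype ι]
    {B : Matrix ι ι ℝ} (hB : B.IsSymm) {a : ℝ} {b : ι → ℝ}
    (h : ∀ (x : ℝ) (y : ι → ℝ), 0 ≤ a * x ^ 2 + 2 * x * (b ⬝ᵥ y) + y ⬝ᵥ B *ᵥ y) :
    ∃ u, B *ᵥ u = b ∧ u ⬝ᵥ b ≤ a := by
  obtain ⟨u, hu⟩ := hB.exists_mulVec_eq (b := b) fun y hy => by
    by_contra hne
    have := h 1 ((-(a + 1) / (2 * (b ⬝ᵥ y))) • y)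
    simp only [mulVec_smul, hy, dotProduct_smul, smul_zero, dotProduct_zero, smul_eq_mul] at this
    field_simp at this
    linarith
  refine ⟨u, hu, ?_⟩
  have := h 1 (-u)
  simp only [mulVec_neg, hu, dotProduct_neg, neg_dotProduct, dotProduct_comm b u] at this
  linarith

/-- If `X` is a real symmetric `m × m` matrix (`m ≥ 2`) whose principal submatrices
`X_{1:(m-1),1:(m-1)}` and `X_{2:m,2:m}` are both positive semidefinite, then there exists a
real number `k` such that setting `X_{1,m} = X_{m,1} = k` makes the matrix positive
semidefinite. -/
theorem stmt_6 (m : ℕ) (hm : 2 ≤ m) (X : Matrix (Fin m) (Fin m) ℝ) (hX : X.IsSymm)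
    (h1 : (leadSub X).PosSemidef) (h2 : (tailSub X).PosSemidef) :
    ∃ k : ℝ, (updCorner X k).PosSemidef := by
  obtain ⟨n, rfl⟩ : ∃ n, m = n + 2 := ⟨m - 2, by omega⟩
  change (X.submatrix (Fin.castSucc : Fin (n + 1) → _) Fin.castSucc).PosSemidef at h1
  change (X.submatrix (Fin.succ : Fin (n + 1) → _) Fin.succ).PosSemidef at h2
  set B : Matrix (Fin n) (Fin n) ℝ :=
    X.submatrix (fun i => i.castSucc.succ) (fun i => i.castSucc.succ)
  have hB : B.PosSemidef := h2.submatrix Fin.castSucc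
  have hBs : B.IsSymm := hX.submatrix _
  obtain ⟨u, hu, hua⟩ := hBs.exists_mulVec_eq_of_bordered_nonneg (a := X 0 0)
    (b := fun i => X 0 i.castSucc.succ) fun x y => by
      have h := h1.dotProduct_mulVec_nonneg (Fin.cons x y)
      rw [star_trivial, (hX.submatrix _).dotProduct_mulVec_eq_succ] at h
      simp only [Fin.cons_zero, Fin.cons_succ, submatrix_submatrix] at h
      exact h
  obtain ⟨v, hv, hvd⟩ := hBs.exists_mulVec_eq_of_bordered_nonneg
    (a := X (Fin.last _) (Fin.last _))
    (b := fun i => X (Fin.last _) i.castSucc.succ) fun x y => by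
      have h := h2.dotProduct_mulVec_nonneg (Fin.snoc (α := fun _ => ℝ) y x)
      rw [star_trivial, (hX.submatrix _).dotProduct_mulVec_eq_castSucc] at h
      simp only [Fin.snoc_last, Fin.snoc_castSucc, submatrix_submatrix] at h
      exact h
  set b : Fin n → ℝ := fun i => X 0 i.castSucc.succ with hb
  set c : Fin n → ℝ := fun i => X (Fin.last _) i.castSucc.succ
  refine ⟨u ⬝ᵥ c, ?_⟩
  have hUs : (updCorner X (u ⬝ᵥ c)).IsSymm := by
    ext i j
    simp only [transpose_apply, updCorner, hX.apply]
    congr 1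
    simp only [eq_iff_iff]
    tauto
  refine .of_dotProduct_mulVec_nonneg
    ((conjTranspose_eq_transpose_of_trivial _).trans hUs) fun w => ?_
  have htail : (updCorner X (u ⬝ᵥ c)).submatrix Fin.succ Fin.succ
      = X.submatrix (Fin.succ : Fin (n + 1) → _) Fin.succ := by
    ext i j
    simp [updCorner]
  have h00 : updCorner X (u ⬝ᵥ c) 0 0 = X 0 0 := by simp [updCorner]
  have hrow (i : Fin n) : updCorner X (u ⬝ᵥ c) 0 i.castSucc.succ = b i := by
    have := i.isLt.ne
    simp [updCorner, hb, this]
  have hlast : updCorner X (u ⬝ᵥ c) 0 (Fin.last n).succ = u ⬝ᵥ c := by simp [updCorner]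
  rw [star_trivial, hUs.dotProduct_mulVec_eq_succ, htail,
    (hX.submatrix _).dotProduct_mulVec_eq_castSucc, h00]
  have hsum : ((fun i : Fin (n + 1) => updCorner X (u ⬝ᵥ c) 0 i.succ) ⬝ᵥ fun i => w i.succ)
      = (b ⬝ᵥ fun i => w i.castSucc.succ) + (u ⬝ᵥ c) * w (Fin.last _) := by
    rw [dotProduct, Fin.sum_univ_castSucc, hlast]
    simp only [hrow]
    rfl
  rw [hsum, submatrix_submatrix]
  simp only [submatrix_apply, Fin.succ_last]
  change 0 ≤ _ + (X (Fin.last (n + 1)) (Fin.last (n + 1)) * _ + 2 * w (Fin.last _) * (c ⬝ᵥ _)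
    + _ ⬝ᵥ B *ᵥ _)
  set y : Fin n → ℝ := fun i => w i.castSucc.succ
  set x := w 0
  set z := w (Fin.last (n + 1))
  have key := hB.dotProduct_mulVec_nonneg (y + x • u + z • v)
  have huy : u ⬝ᵥ B *ᵥ y = b ⬝ᵥ y := by
    rw [dotProduct_mulVec, ← mulVec_transpose, hBs.eq, hu]
  have hvy : v ⬝ᵥ B *ᵥ y = c ⬝ᵥ y := by
    rw [dotProduct_mulVec, ← mulVec_transpose, hBs.eq, hv]
  have hvu : v ⬝ᵥ b = u ⬝ᵥ c := by
    rw [← hu, dotProduct_mulVec, ← mulVec_transpose, hBs.eq, hv, dotProduct_comm]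
  simp only [star_trivial, mulVec_add, mulVec_smul, hu, hv, dotProduct_add, add_dotProduct,
    dotProduct_smul, smul_dotProduct, smul_eq_mul, huy, hvy, hvu, dotProduct_comm y b,
    dotProduct_comm y c] at key
  nlinarith [mul_nonneg (sub_nonneg.2 hua) (sq_nonneg x),
    mul_nonneg (sub_nonneg.2 hvd) (sq_nonneg z)]
end

section
/- Let X be a real symmetric m×m matrix with m ≥ 2, and for t ∈ ℝ let X(t) denote the matrix obtained from X by replacing the entries in positions (1,m) and (m,1) by t. Then there exist real numbers a, b, c such that det(X(t)) = a·t² + b·t + c for all t ∈ ℝ, and moreover b² − 4ac = 4·det(X_{1:(m−1),1:(m−1)})·det(X_{2:m,2:m}). -/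
open Matrix

/-- The Schur complement formula for an invertible matrix `A` bordered by the rows of `W`, the
columns of `Wᵀ` and the corner block `D`, up to a reindexing `f`. -/
theorem det_submatrix_bordered {n k l : ℕ} (M : Matrix (Fin n) (Fin n) ℝ)
    (A : Matrix (Fin k) (Fin k) ℝ) (W : Matrix (Fin l) (Fin k) ℝ) (D : Matrix (Fin l) (Fin l) ℝ)
    (hA : A.det ≠ 0) (hn : n = k + l) (f : Fin k ⊕ Fin l → Fin n) (hf : Function.Injective f)
    (hM : M.submatrix f f = fromBlocks A Wᵀ W D) :
    M.det = A.det * (D - W * A⁻¹ * Wᵀ).det := by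
  have hb : Function.Bijective f :=
    (Fintype.bijective_iff_injective_and_card f).2 ⟨hf, by simp [hn]⟩
  have := invertibleOfIsUnitDet A (isUnit_iff_ne_zero.2 hA)
  rw [← invOf_eq_nonsing_inv, ← det_fromBlocks₁₁, ← hM]
  exact (det_submatrix_equiv_self (Equiv.ofBijective f hb) M).symm

/-- The central block of a matrix, without the first and last rows and columns. -/
def midSub {k : ℕ} (X : Matrix (Fin (k + 2)) (Fin (k + 2)) ℝ) : Matrix (Fin k) (Fin k) ℝ :=
  X.submatrix (fun i => i.succ.castSucc) (fun i => i.succ.castSucc)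

theorem exists_dets_eq_of_det_midSub_ne_zero {k : ℕ} (X : Matrix (Fin (k + 2)) (Fin (k + 2)) ℝ)
    (hX : X.IsSymm) (h : (midSub X).det ≠ 0) :
    ∃ p q r : ℝ,
      (∀ t, (updCorner X t).det = (midSub X).det * (p * q - (t - r) ^ 2)) ∧
      (leadSub X).det = (midSub X).det * p ∧ (tailSub X).det = (midSub X).det * q := by
  set W : Matrix (Fin 2) (Fin k) ℝ :=
    X.submatrix ![0, Fin.last (k + 1)] (fun i => i.succ.castSucc) with hW
  set S := W * (midSub X)⁻¹ * Wᵀ with hS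
  have hB : (midSub X)ᵀ = midSub X := by
    ext i j
    exact hX.apply _ _
  have hSymm : S 1 0 = S 0 1 := by
    have : Sᵀ = S := by
      rw [hS]
      simp [transpose_mul, transpose_nonsing_inv, hB, Matrix.mul_assoc]
    exact congrFun (congrFun this 0) 1
  have hdiag (a : Fin 2) : (W.submatrix (fun _ : Fin 1 => a) id * (midSub X)⁻¹ *
      (W.submatrix (fun _ : Fin 1 => a) id)ᵀ) 0 0 = S a a := by
    simp [hS, Matrix.mul_apply]
  refine ⟨X 0 0 - S 0 0, X (Fin.last _) (Fin.last _) - S 1 1, S 0 1, fun t => ?_, ?_, ?_⟩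
  · rw [det_submatrix_bordered (updCorner X t) (midSub X) W
      !![X 0 0, t; t, X (Fin.last _) (Fin.last _)] h rfl
      (Sum.elim (fun i => i.succ.castSucc) ![0, Fin.last (k + 1)]), det_fin_two]
    · simp only [← hS, Matrix.sub_apply, hSymm]
      simp only [of_apply, cons_val', cons_val_zero, cons_val_one, cons_val_fin_one]
      ring
    · rintro (i | i) (j | j) hij
      · simpa using hij
      · fin_cases j <;> simp [Fin.ext_iff] at hij <;> omega
      · fin_cases i <;> simp [Fin.ext_iff] at hij <;> omega
      · fin_cases i <;> fin_cases j <;> simp [Fin.ext_iff] at hij ⊢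
    · ext (i | i) (j | j)
      · simp [updCorner, midSub]
      · have := i.2
        fin_cases j <;> exact (if_neg (by simp; try omega)).trans (hX.apply _ _)
      · have := j.2
        fin_cases i <;> exact if_neg (by simp; try omega)
      · fin_cases i <;> fin_cases j <;> simp [updCorner]
  · rw [det_submatrix_bordered (leadSub X) (midSub X) (W.submatrix (fun _ : Fin 1 => 0) id)
      !![X 0 0] h rfl (Sum.elim Fin.succ (fun _ => (0 : Fin (k + 1)))), det_fin_one, Matrix.sub_apply, hdiag]
    · simp
    · rintro (i | i) (j | j) hij <;> simp_all [Fin.ext_iff]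
    · ext (i | i) (j | j)
      · rfl
      · exact hX.apply _ _
      · rfl
      · fin_cases i; fin_cases j; rfl
  · rw [det_submatrix_bordered (tailSub X) (midSub X) (W.submatrix (fun _ : Fin 1 => 1) id)
      !![X (Fin.last _) (Fin.last _)] h rfl (Sum.elim Fin.castSucc (fun _ => Fin.last k)),
      det_fin_one, Matrix.sub_apply, hdiag]
    · simp
    · rintro (i | i) (j | j) hij <;> simp [Fin.ext_iff] at hij ⊢ <;> omega
    · ext (i | i) (j | j)
      · rfl
      · exact hX.apply _ _
      · rfl
      · fin_cases i; fin_cases j; rfl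

theorem dense_det_add_smul_one_ne_zero {k : ℕ} (A : Matrix (Fin k) (Fin k) ℝ) :
    Dense {x : ℝ | (A + x • 1).det ≠ 0} := by
  have hfin : {x : ℝ | (-A).charpoly.IsRoot x}.Finite :=
    Polynomial.finite_setOfPred_isRoot (charpoly_monic _).ne_zero
  refine ((Set.Finite.countable hfin).dense_compl ℝ).mono fun x hx => ?_
  simpa [Polynomial.IsRoot, eval_charpoly, add_comm, smul_one_eq_diagonal] using hx

theorem midSub_add_smul_one {k : ℕ} (X : Matrix (Fin (k + 2)) (Fin (k + 2)) ℝ) (x : ℝ) :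
    midSub (X + x • 1) = midSub X + x • 1 := by
  ext i j
  simp [midSub, Matrix.one_apply]

/-- For a real symmetric `m × m` matrix `X` with `m ≥ 2`, `det (X(t))` is a quadratic
function `a t² + b t + c` of `t`, and its discriminant satisfies
`b² - 4 a c = 4 det (X_{1:(m-1),1:(m-1)}) det (X_{2:m,2:m})`. -/
theorem stmt_8 (m : ℕ) (hm : 2 ≤ m) (X : Matrix (Fin m) (Fin m) ℝ) (hX : X.IsSymm) :
    ∃ a b c : ℝ,
      (∀ t : ℝ, (updCorner X t).det = a * t ^ 2 + b * t + c) ∧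
      b ^ 2 - 4 * a * c = 4 * (leadSub X).det * (tailSub X).det := by
  obtain ⟨k, rfl⟩ : ∃ k, m = k + 2 := ⟨m - 2, by omega⟩
  have hdense := dense_det_add_smul_one_ne_zero (midSub X)
  have hupd (t : ℝ) : Continuous fun x : ℝ => (updCorner (X + x • 1) t).det := by
    refine Continuous.matrix_det (continuous_matrix fun i j => ?_)
    unfold updCorner
    split_ifs <;> fun_prop
  have hlead : Continuous fun x : ℝ => (leadSub (X + x • 1)).det := by
    unfold leadSub
    fun_prop
  have htail : Continuous fun x : ℝ => (tailSub (X + x • 1)).det := by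
    unfold tailSub
    fun_prop
  have hdets (x : ℝ) (hx : (midSub X + x • 1).det ≠ 0) :=
    exists_dets_eq_of_det_midSub_ne_zero (X + x • 1)
      (hX.add (isSymm_one.smul x)) (by rwa [midSub_add_smul_one])
  let f (x t : ℝ) : ℝ := (updCorner (X + x • 1) t).det
  have hf (t : ℝ) : Continuous fun x => f x t := hupd t
  let a (x : ℝ) : ℝ := (f x 1 + f x (-1)) / 2 - f x 0
  let b (x : ℝ) : ℝ := (f x 1 - f x (-1)) / 2
  have ha : Continuous a := (((hf 1).add (hf (-1))).div_const 2).sub (hf 0)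
  have hb : Continuous b := ((hf 1).sub (hf (-1))).div_const 2
  have hquad (t : ℝ) : (fun x => f x t) = fun x => a x * t ^ 2 + b x * t + f x 0 := by
    refine Continuous.ext_on hdense (hf t)
      (((ha.mul continuous_const).add (hb.mul continuous_const)).add (hf 0)) fun x hx => ?_
    obtain ⟨p, q, r, hdet, -, -⟩ := hdets x hx
    simp only [a, b, f, hdet]
    ring
  have hdisc : (fun x => b x ^ 2 - 4 * a x * f x 0) =
      fun x => 4 * (leadSub (X + x • 1)).det * (tailSub (X + x • 1)).det := by
    refine Continuous.ext_on hdense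
      ((hb.pow 2).sub ((continuous_const.mul ha).mul (hf 0)))
      ((continuous_const.mul hlead).mul htail) fun x hx => ?_
    obtain ⟨p, q, r, hdet, hl, ht⟩ := hdets x hx
    simp only [a, b, f, hdet, hl, ht]
    ring
  refine ⟨a 0, b 0, f 0 0, fun t => ?_, ?_⟩
  · simpa [f] using congrFun (hquad t) 0
  · simpa using congrFun hdisc 0
end

section
/- Let X be a real symmetric m×m matrix with m ≥ 3. If (i) X_{1:(m−1),1:(m−1)} and X_{2:m,2:m} are positive semidefinite, (ii) X_{2:(m−1),2:(m−1)} is positive definite, and (iii) det(X) ≥ 0, then X is positive semidefinite. -/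
open Matrix

/-- The inner principal submatrix `X_{2:(m-1),2:(m-1)}` (`0`-based: rows/cols `1,…,m-2`). -/
def innerSub {m : ℕ} (X : Matrix (Fin m) (Fin m) ℝ) : Matrix (Fin (m - 2)) (Fin (m - 2)) ℝ :=
  X.submatrix (fun i => ⟨(i : ℕ) + 1, by omega⟩) (fun i => ⟨(i : ℕ) + 1, by omega⟩)

/-- A real Hermitian `2 × 2` matrix with nonnegative diagonal and nonnegative determinant is
positive semidefinite. -/
theorem posSemidef_fin_two_of_diag_nonneg_of_det_nonneg {S : Matrix (Fin 2) (Fin 2) ℝ}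
    (hS : S.IsHermitian) (hdiag : ∀ i, 0 ≤ S i i) (hdet : 0 ≤ S.det) : S.PosSemidef := by
  refine PosSemidef.of_dotProduct_mulVec_nonneg hS fun x => ?_
  have h10 : S 1 0 = S 0 1 := by simpa using hS.apply 0 1
  have ha := hdiag 0
  have hc := hdiag 1
  rw [det_fin_two, h10] at hdet
  simp only [dotProduct, mulVec, Fin.sum_univ_two, Pi.star_apply, star_trivial, h10]
  rcases ha.eq_or_lt with ha0 | hapos
  · have hb : S 0 1 = 0 := by nlinarith
    rw [hb, ← ha0]
    nlinarith [mul_nonneg hc (sq_nonneg (x 1))]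
  · refine nonneg_of_mul_nonneg_right (a := S 0 0) ?_ hapos
    nlinarith [sq_nonneg (S 0 0 * x 0 + S 0 1 * x 1), mul_nonneg hdet (sq_nonneg (x 1))]

/-- Bordering a positive definite block `A` by two rows and columns: the block matrix is positive
semidefinite as soon as its determinant is nonnegative and each single bordering of `A` is
positive semidefinite. -/
theorem posSemidef_fromBlocks_of_det_nonneg {n : Type*} [Fintype n] [DecidableEq n]
    {A : Matrix n n ℝ} {B : Matrix n (Fin 2) ℝ} {D : Matrix (Fin 2) (Fin 2) ℝ}
    (hA : A.PosDef) (hD : D.IsHermitian)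
    (hborder : ∀ i, ((fromBlocks A B Bᴴ D).submatrix (Sum.map id fun _ : Unit => i)
      (Sum.map id fun _ : Unit => i)).PosSemidef)
    (hdet : 0 ≤ (fromBlocks A B Bᴴ D).det) : (fromBlocks A B Bᴴ D).PosSemidef := by
  have := hA.isUnit.invertible
  rw [PosDef.fromBlocks₁₁ B D hA]
  refine posSemidef_fin_two_of_diag_nonneg_of_det_nonneg ?_ (fun i => ?_) ?_
  · exact hD.sub (isHermitian_conjTranspose_mul_mul B hA.1.inv)
  · have hsub : (fromBlocks A B Bᴴ D).submatrix (Sum.map id fun _ : Unit => i)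
        (Sum.map id fun _ : Unit => i) =
        fromBlocks A (B.submatrix id fun _ : Unit => i) (B.submatrix id fun _ : Unit => i)ᴴ
          (D.submatrix (fun _ : Unit => i) fun _ : Unit => i) := by
      ext (a | a) (b | b) <;> rfl
    have h := hborder i
    rw [hsub, PosDef.fromBlocks₁₁ _ _ hA] at h
    exact h.diag_nonneg (i := ())
  · rw [det_fromBlocks₁₁, invOf_eq_nonsing_inv] at hdet
    exact nonneg_of_mul_nonneg_right hdet hA.det_pos

/-- The reindexing of `Fin (k + 2)` listing the inner indices first, then the first and last. -/
noncomputable def innerSumEndsEquiv (k : ℕ) : Fin k ⊕ Fin 2 ≃ Fin (k + 2) :=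
  Equiv.ofBijective (Sum.elim (fun i => i.succ.castSucc) ![0, Fin.last (k + 1)]) <| by
    rw [Fintype.bijective_iff_injective_and_card]
    refine ⟨?_, by simp⟩
    rintro (a | a) (b | b) h
    · simpa using h
    · fin_cases b <;> (simp [Fin.ext_iff] at h; try omega)
    · fin_cases a <;> (simp [Fin.ext_iff] at h; try omega)
    · fin_cases a <;> fin_cases b <;> simp [Fin.ext_iff] at h ⊢

/-- Let `X` be a real symmetric `m × m` matrix with `m ≥ 3`. If `X_{1:(m-1),1:(m-1)}` and
`X_{2:m,2:m}` are positive semidefinite, `X_{2:(m-1),2:(m-1)}` is positive definite, and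
`det X ≥ 0`, then `X` is positive semidefinite. -/
theorem stmt_9 (m : ℕ) (hm : 3 ≤ m) (X : Matrix (Fin m) (Fin m) ℝ) (hX : X.IsSymm)
    (h1 : (leadSub X).PosSemidef) (h2 : (tailSub X).PosSemidef)
    (h3 : (innerSub X).PosDef) (h4 : 0 ≤ X.det) :
    X.PosSemidef := by
  obtain ⟨k, rfl⟩ : ∃ k, m = k + 2 := ⟨m - 2, by omega⟩
  have hXh : X.IsHermitian := (conjTranspose_eq_transpose_of_trivial X).trans hX
  have hYh := hXh.submatrix (innerSumEndsEquiv k)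
  rw [← posSemidef_submatrix_equiv (innerSumEndsEquiv k)]
  rw [← det_submatrix_equiv_self (innerSumEndsEquiv k)] at h4
  have hblocks : X.submatrix (innerSumEndsEquiv k) (innerSumEndsEquiv k) =
      fromBlocks (innerSub X) (X.submatrix (innerSumEndsEquiv k) (innerSumEndsEquiv k)).toBlocks₁₂
        ((X.submatrix (innerSumEndsEquiv k) (innerSumEndsEquiv k)).toBlocks₁₂)ᴴ
        (X.submatrix (innerSumEndsEquiv k) (innerSumEndsEquiv k)).toBlocks₂₂ := by
    ext (a | a) (b | b)
    · rfl
    · rfl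
    · exact (hYh.apply _ _).symm
    · rfl
  rw [hblocks] at h4 ⊢
  refine posSemidef_fromBlocks_of_det_nonneg h3 (hYh.submatrix Sum.inr) (fun i => ?_) h4
  rw [← hblocks, submatrix_submatrix]
  fin_cases i
  · convert h1.submatrix (Sum.elim (fun a : Fin (k + 2 - 2) => Fin.succ (n := k) a) fun _ : Unit =>
      (0 : Fin (k + 1))) using 1
    ext (a | a) (b | b) <;> rfl
  · convert h2.submatrix (Sum.elim (fun a : Fin (k + 2 - 2) => Fin.castSucc (n := k) a) fun _ : Unit =>
      Fin.last k) using 1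
    ext (a | a) (b | b) <;> rfl
end

section
/- Let X be a real symmetric m×m matrix with m ≥ 3. If X_{1:(m−1),1:(m−1)} and X_{2:m,2:m} are positive semidefinite and the inner block X_{2:(m−1),2:(m−1)} is not invertible, then det(X) = 0. -/
open Matrix

/-- If a compression `A.submatrix f f` of a positive semidefinite matrix kills `v`, then so does
the full column block `A.submatrix id f`. -/
theorem Matrix.PosSemidef.submatrix_id_mulVec_eq_zero {n p : Type*} [Fintype n] [DecidableEq n]
    [Fintype p] {A : Matrix n n ℝ} (hA : A.PosSemidef) (f : p → n) {v : p → ℝ}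
    (hv : A.submatrix f f *ᵥ v = 0) : A.submatrix id f *ᵥ v = 0 := by
  have hAP : A * (1 : Matrix n n ℝ).submatrix id f = A.submatrix id f := by
    ext i j
    simp [Matrix.mul_apply, Matrix.one_apply]
  rw [← hAP, ← mulVec_mulVec]
  rw [← hA.dotProduct_mulVec_zero_iff, mulVec_mulVec, hAP]
  have hPA : ((1 : Matrix n n ℝ).submatrix id f)ᵀ * A.submatrix id f = A.submatrix f f := by
    ext i j
    simp [Matrix.mul_apply, Matrix.one_apply]
  rw [star_trivial, ← vecMul_transpose, ← dotProduct_mulVec, mulVec_mulVec, hPA, hv,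
    dotProduct_zero]

/-- A square matrix is singular if some injectively indexed block of its columns kills a nonzero
vector. -/
theorem Matrix.det_eq_zero_of_submatrix_id_mulVec_eq_zero {n p : Type*} [Fintype n]
    [DecidableEq n] [Fintype p] {A : Matrix n n ℝ} {f : p → n} (hf : f.Injective) {v : p → ℝ}
    (hv : v ≠ 0) (h : A.submatrix id f *ᵥ v = 0) : A.det = 0 := by
  classical
  rw [← exists_mulVec_eq_zero_iff]
  refine ⟨(1 : Matrix n n ℝ).submatrix id f *ᵥ v, fun h0 => hv ?_, ?_⟩
  · ext j
    simpa [mulVec, dotProduct, Matrix.one_apply, hf.eq_iff] using congrFun h0 (f j)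
  · rw [mulVec_mulVec, ← h]
    congr 1
    ext i j
    simp [Matrix.mul_apply, Matrix.one_apply]

/-- Let `X` be a real symmetric `m × m` matrix with `m ≥ 3`. If `X_{1:(m-1),1:(m-1)}` and
`X_{2:m,2:m}` are positive semidefinite and the inner block `X_{2:(m-1),2:(m-1)}` is not
invertible, then `det X = 0`. -/
theorem stmt_10 (m : ℕ) (hm : 3 ≤ m) (X : Matrix (Fin m) (Fin m) ℝ) (hX : X.IsSymm)
    (h1 : (leadSub X).PosSemidef) (h2 : (tailSub X).PosSemidef)
    (h3 : ¬ IsUnit (innerSub X)) :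
    X.det = 0 := by
  have hdet : (innerSub X).det = 0 := by
    simpa [isUnit_iff_isUnit_det] using h3
  obtain ⟨v, hv, hv0⟩ := exists_mulVec_eq_zero_iff.mpr hdet
  have hlead := h1.submatrix_id_mulVec_eq_zero
    (fun i : Fin (m - 2) => ⟨(i : ℕ) + 1, by omega⟩) (v := v) hv0
  have htail := h2.submatrix_id_mulVec_eq_zero
    (fun i : Fin (m - 2) => ⟨(i : ℕ), by omega⟩) (v := v) hv0
  refine det_eq_zero_of_submatrix_id_mulVec_eq_zero
    (f := fun i : Fin (m - 2) => ⟨(i : ℕ) + 1, by omega⟩) (fun i j hij => ?_) hv ?_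
  · simpa [Fin.ext_iff] using hij
  · ext ⟨i, hi⟩
    by_cases hi' : i < m - 1
    · exact congrFun hlead ⟨i, hi'⟩
    · obtain ⟨k, rfl⟩ : ∃ k, i = k + 1 := ⟨i - 1, by omega⟩
      exact congrFun htail ⟨k, by omega⟩
end

section
/- Let A = [[A₁, A₂], [A₂ᵀ, A₃]] be a real symmetric block matrix, where A₁ is an invertible p×p block, A₂ is p×q, and A₃ is a symmetric q×q block. If rank(A) = rank(A₁) = p, then A₃ = A₂ᵀ A₁⁻¹ A₂. -/
open Matrix

/-- A block matrix whose rank does not exceed that of its invertible upper left block has zero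
Schur complement. -/
theorem Matrix.eq_mul_inv_mul_of_rank_fromBlocks_le {K m n o : Type*} [Field K] [Fintype m]
    [DecidableEq m] [Fintype n] [DecidableEq n] [Fintype o]
    {A : Matrix m m K} {B : Matrix m n K} {C : Matrix o m K} {D : Matrix o n K}
    (hA : IsUnit A.det) (h : (fromBlocks A B C D).rank ≤ A.rank) :
    D = C * A⁻¹ * B := by
  have hAN : A.rank ≤ (fromRows A C).rank := by
    have := rank_mul_le_right (fromCols (1 : Matrix m m K) (0 : Matrix m o K)) (fromRows A C)
    rwa [fromCols_mul_fromRows, Matrix.one_mul, Matrix.zero_mul, add_zero] at this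
  have hle : LinearMap.range (fromRows A C).mulVecLin ≤
      LinearMap.range (fromBlocks A B C D).mulVecLin := by
    rintro _ ⟨u, rfl⟩
    refine ⟨Sum.elim u 0, ?_⟩
    simp [fromBlocks_mulVec, fromRows_mulVec]
  have heq := Submodule.eq_of_le_of_finrank_le hle (h.trans hAN)
  refine ext_of_mulVec_single fun j => ?_
  set w : n → K := Pi.single j 1
  obtain ⟨u, hu⟩ : (fromBlocks A B C D) *ᵥ Sum.elim 0 w ∈
      LinearMap.range (fromRows A C).mulVecLin := heq ▸ ⟨_, rfl⟩
  simp only [mulVecLin_apply, fromRows_mulVec, fromBlocks_mulVec, Sum.elim_comp_inl,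
    Sum.elim_comp_inr, mulVec_zero, zero_add, Sum.elim_eq_iff] at hu
  rw [← hu.2, ← mulVec_mulVec, ← hu.1, mulVec_mulVec, nonsing_inv_mul_cancel_right _ _ hA]

/-- Let `A = [[A₁, A₂], [A₂ᵀ, A₃]]` be a real symmetric block matrix where `A₁` is an
invertible `p × p` block, `A₂` is `p × q`, and `A₃` is a symmetric `q × q` block. If
`rank A = rank A₁ = p`, then `A₃ = A₂ᵀ A₁⁻¹ A₂`. -/
theorem stmt_13 (p q : ℕ) (A₁ : Matrix (Fin p) (Fin p) ℝ) (A₂ : Matrix (Fin p) (Fin q) ℝ)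
    (A₃ : Matrix (Fin q) (Fin q) ℝ) (hA₃ : A₃.IsSymm)
    (hsymm : (Matrix.fromBlocks A₁ A₂ A₂ᵀ A₃).IsSymm)
    (hA₁ : IsUnit A₁.det)
    (hrank₁ : (Matrix.fromBlocks A₁ A₂ A₂ᵀ A₃).rank = A₁.rank)
    (hrank₂ : A₁.rank = p) :
    A₃ = A₂ᵀ * A₁⁻¹ * A₂ := by
  exact eq_mul_inv_mul_of_rank_fromBlocks_le hA₁ hrank₁.le
end
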